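/- Let p : ℝ² → ℝ be smooth, nonnegative, supported in B(0,1/2), with ∫ p = 1, and let h : 𝕋² → ℝ be bounded measurable; set K₂ := K̄₂ + h on the torus. Then there exists a constant C, depending only on p and ‖h‖_{L^∞}, such that for every ε ∈ (0, 1/4], ∫_{[−1/2,1/2]²} (K₂ ∗ p^ε(x))² |x| dx ≤ C, where ∗ denotes convolution on the torus, x is the representative of a torus point in the fundamental domain [−1/2,1/2]², and p^ε(x) := ε⁻² p(x/ε). -/

import Mathlib

open MeasureTheory Real

noncomputable section

/-- The fundamental square `[−1/2,1/2]²` of the flat torus `𝕋²`. -/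
def sq2 : Set (EuclideanSpace ℝ (Fin 2)) :=
  {x | ∀ i, x i ∈ Set.Icc (-(1/2) : ℝ) (1/2)}

/-- Second component of the planar Biot–Savart kernel: `K̄₂(x) = x₁/(2π|x|²)`. -/
def Kbar2 (x : EuclideanSpace ℝ (Fin 2)) : ℝ := x 0 / (2 * π * ‖x‖ ^ 2)

/-- Reduction of a point of `ℝ²` to its periodic representative in `[−1/2,1/2)²`. -/
def rep2 (x : EuclideanSpace ℝ (Fin 2)) : EuclideanSpace ℝ (Fin 2) :=
  (WithLp.equiv 2 (Fin 2 → ℝ)).symm fun i => Int.fract (x i + 1/2) - 1/2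


def phi2 (z : EuclideanSpace ℝ (Fin 2)) : ℝ := (Set.Iio (1:ℝ)).indicator (fun r => r⁻¹) ‖z‖

lemma phi2_nonneg (z : EuclideanSpace ℝ (Fin 2)) : 0 ≤ phi2 z := by
  unfold phi2
  rw [Set.indicator_apply]
  split_ifs
  · exact inv_nonneg.2 (norm_nonneg z)
  · exact le_rfl

lemma phi2_integrable : Integrable phi2 := by
  unfold phi2
  rw [integrable_fun_norm_addHaar (volume : Measure (EuclideanSpace ℝ (Fin 2)))
    (f := (Set.Iio (1:ℝ)).indicator (fun r => r⁻¹))]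
  have h1 : IntegrableOn ((Set.Iio (1:ℝ)).indicator (fun _ => (1:ℝ))) (Set.Ioi 0) := by
    rw [IntegrableOn, integrable_indicator_iff measurableSet_Iio, IntegrableOn,
      Measure.restrict_restrict measurableSet_Iio]
    have : IntegrableOn (fun _ : ℝ => (1:ℝ)) (Set.Ioo 0 1) := by simp
    refine this.mono_set ?_
    rintro x ⟨a, b⟩
    exact ⟨b, a⟩
  refine h1.congr_fun ?_ measurableSet_Ioi
  intro y hy
  have hy : 0 < y := hy
  by_cases h : y < 1
  · simp [h, hy.ne']
  · simp [h]

lemma rep2_coord (x : EuclideanSpace ℝ (Fin 2)) (i : Fin 2) : rep2 x i = x i - (⌊x i + 1/2⌋ : ℝ) := by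
  simp only [rep2, Int.fract]
  change x i + 1/2 - (⌊x i + 1/2⌋ : ℝ) - 1/2 = _
  ring

lemma abs_le_sub_int (a : ℝ) (ha : a ∈ Set.Icc (-(1/2) : ℝ) (1/2)) (n : ℤ) :
    |a| ≤ |a - n| := by
  obtain ⟨h1, h2⟩ := ha
  have h3 : |a| ≤ 1/2 := abs_le.2 ⟨h1, h2⟩
  by_cases hn : n = 0
  · simp [hn]
  · have : (1:ℝ) ≤ |(n:ℝ)| := by exact_mod_cast Int.one_le_abs hn
    have h4 := abs_sub_abs_le_abs_sub (n:ℝ) a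
    rw [abs_sub_comm] at h4
    linarith

lemma norm_le_of_coord (x y : EuclideanSpace ℝ (Fin 2)) (h : ∀ i, |x i| ≤ |y i|) : ‖x‖ ≤ ‖y‖ := by
  rw [EuclideanSpace.norm_eq, EuclideanSpace.norm_eq]
  apply Real.sqrt_le_sqrt
  apply Finset.sum_le_sum
  intro i _
  have := h i
  simp only [Real.norm_eq_abs]
  gcongr

lemma norm_tri (x y : EuclideanSpace ℝ (Fin 2)) (hx : x ∈ sq2) : ‖x‖ ≤ ‖y‖ + ‖rep2 (x - y)‖ := by
  refine le_trans (norm_le_of_coord x (y + rep2 (x - y)) ?_) (norm_add_le _ _)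
  intro i
  have := abs_le_sub_int (x i) (hx i) ⌊(x - y) i + 1/2⌋
  rw [PiLp.add_apply, rep2_coord]
  convert this using 2
  simp only [PiLp.sub_apply]
  ring

lemma coord_le (x : EuclideanSpace ℝ (Fin 2)) (i : Fin 2) : |x i| ≤ ‖x‖ := by
  simpa using PiLp.norm_apply_le x i

lemma rep2_eq (x : EuclideanSpace ℝ (Fin 2)) (hx : ‖x‖ < 1/2) : rep2 x = x := by
  ext i
  rw [rep2_coord]
  have := (coord_le x i).trans_lt hx
  rw [abs_lt] at this
  have h0 : ⌊x i + 1/2⌋ = 0 := by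
    rw [Int.floor_eq_zero_iff]
    constructor <;> linarith [this.1, this.2]
  rw [h0]
  simp

lemma rep2_near (x y : EuclideanSpace ℝ (Fin 2)) (hx : x ∈ sq2) (ε : ℝ) (he : ε ≤ 1/4)
    (hy : ‖y‖ < ε / 2) (hr : ‖rep2 (x - y)‖ < ε) : rep2 (x - y) = x - y := by
  have h1 := norm_tri x y hx
  apply rep2_eq
  have := norm_sub_le x y
  linarith

lemma sq2_norm_lt (x : EuclideanSpace ℝ (Fin 2)) (hx : x ∈ sq2) : ‖x‖ < 1 := by
  rw [EuclideanSpace.norm_eq, Real.sqrt_lt' one_pos, Fin.sum_univ_two]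
  have h0 := abs_le.2 (hx 0)
  have h1 := abs_le.2 (hx 1)
  simp only [Real.norm_eq_abs]
  nlinarith [abs_nonneg (x 0), abs_nonneg (x 1)]

lemma Kbar2_abs (z : EuclideanSpace ℝ (Fin 2)) : |Kbar2 z| ≤ ‖z‖⁻¹ := by
  unfold Kbar2
  by_cases hz : z = 0
  · simp [hz]
  have hz : 0 < ‖z‖ := norm_pos_iff.2 hz
  have h2 : (1:ℝ) ≤ 2 * π := by linarith [Real.pi_gt_three]
  rw [abs_div, abs_of_pos (by positivity : 0 < 2 * π * ‖z‖ ^ 2), div_le_iff₀ (by positivity)]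
  have h3 : ‖z‖⁻¹ * (2 * π * ‖z‖^2) = 2 * π * ‖z‖ := by field_simp
  rw [h3]
  nlinarith [coord_le z 0]

lemma inv_rep_bound (x y : EuclideanSpace ℝ (Fin 2)) (hx : x ∈ sq2) (ε : ℝ) (h0 : 0 < ε) (he : ε ≤ 1/4)
    (hy : ‖y‖ < ε / 2) :
    ‖rep2 (x - y)‖⁻¹ ≤ ε⁻¹ * (1 + phi2 (ε⁻¹ • x - ε⁻¹ • y)) := by
  have hp := phi2_nonneg (ε⁻¹ • x - ε⁻¹ • y)
  by_cases hr : ‖rep2 (x - y)‖ < ε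
  · have h1 := rep2_near x y hx ε he hy hr
    rw [h1] at hr ⊢
    have h2 : ‖ε⁻¹ • x - ε⁻¹ • y‖ = ε⁻¹ * ‖x - y‖ := by
      rw [← smul_sub, norm_smul, Real.norm_of_nonneg (by positivity)]
    have h3 : ε⁻¹ * ‖x - y‖ < 1 := by
      rw [inv_mul_lt_iff₀ h0]; linarith
    have h4 : phi2 (ε⁻¹ • x - ε⁻¹ • y) = ε * ‖x - y‖⁻¹ := by
      unfold phi2
      rw [h2, Set.indicator_of_mem (by exact h3), mul_inv, inv_inv]
    rw [h4]
    have : ε⁻¹ * (1 + ε * ‖x - y‖⁻¹) = ε⁻¹ + ‖x - y‖⁻¹ := by field_simp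
    rw [this]
    have : 0 < ε⁻¹ := by positivity
    linarith
  · have h1 : ‖rep2 (x - y)‖⁻¹ ≤ ε⁻¹ := inv_anti₀ h0 (not_lt.1 hr)
    have : 0 < ε⁻¹ := by positivity
    nlinarith

lemma pointwise_bound (p : EuclideanSpace ℝ (Fin 2) → ℝ) (hp0 : ∀ x, 0 ≤ p x) (hps : ∀ x, p x ≠ 0 → ‖x‖ < 1/2)
    (B : ℝ) (hB : ∀ x, p x ≤ B) (M : ℝ) (h : EuclideanSpace ℝ (Fin 2) → ℝ) (hM : ∀ x, |h x| ≤ M)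
    (ε : ℝ) (h0 : 0 < ε) (he : ε ≤ 1/4) (x y : EuclideanSpace ℝ (Fin 2)) (hx : x ∈ sq2) :
    ‖x‖ * (|Kbar2 (rep2 (x - y)) + h (rep2 (x - y))| * p (ε⁻¹ • y)) ≤
      (2 + |M|) * p (ε⁻¹ • y) + B * phi2 (ε⁻¹ • x - ε⁻¹ • y) := by
  have hφ := phi2_nonneg (ε⁻¹ • x - ε⁻¹ • y)
  have hpn := hp0 (ε⁻¹ • y)
  have hb := hB (ε⁻¹ • y)
  by_cases hz : p (ε⁻¹ • y) = 0
  · rw [hz] at hb ⊢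
    simp only [mul_zero, zero_add]
    positivity
  have h1 := hps _ hz
  rw [norm_smul, Real.norm_of_nonneg (by positivity), inv_mul_lt_iff₀ h0] at h1
  have hy : ‖y‖ < ε / 2 := by linarith
  have h2 := inv_rep_bound x y hx ε h0 he hy
  have h3 := norm_tri x y hx
  have h4 := Kbar2_abs (rep2 (x - y))
  have h5 := hM (rep2 (x - y))
  have h6 := sq2_norm_lt x hx
  set z := rep2 (x - y)
  set φ := phi2 (ε⁻¹ • x - ε⁻¹ • y)
  have h7 : |Kbar2 z + h z| ≤ ‖z‖⁻¹ + |M| :=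
    (abs_add_le _ _).trans (add_le_add h4 (h5.trans (le_abs_self M)))
  have h8 : ‖y‖ * ‖z‖⁻¹ ≤ 1 + φ := by
    calc ‖y‖ * ‖z‖⁻¹ ≤ ε * (ε⁻¹ * (1 + φ)) := by
          gcongr; linarith
      _ = 1 + φ := by field_simp
  have h9 : ‖z‖ * ‖z‖⁻¹ ≤ 1 := mul_inv_le_one
  have h10 : ‖x‖ * ‖z‖⁻¹ ≤ 2 + φ := by
    have : ‖x‖ * ‖z‖⁻¹ ≤ (‖y‖ + ‖z‖) * ‖z‖⁻¹ := by gcongr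
    linarith
  have h11 : ‖x‖ * |Kbar2 z + h z| ≤ 2 + |M| + φ := by
    have : ‖x‖ * |Kbar2 z + h z| ≤ ‖x‖ * (‖z‖⁻¹ + |M|) := by gcongr
    nlinarith [abs_nonneg M]
  nlinarith

lemma conv_bound (p : EuclideanSpace ℝ (Fin 2) → ℝ) (hp0 : ∀ x, 0 ≤ p x) (hps : ∀ x, p x ≠ 0 → ‖x‖ < 1/2)
    (hpint : Integrable p) (hpi : (∫ x : EuclideanSpace ℝ (Fin 2), p x) = 1)
    (B : ℝ) (hB : ∀ x, p x ≤ B) (M : ℝ) (h : EuclideanSpace ℝ (Fin 2) → ℝ) (hM : ∀ x, |h x| ≤ M)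
    (ε : ℝ) (h0 : 0 < ε) (he : ε ≤ 1/4) (x : EuclideanSpace ℝ (Fin 2)) (hx : x ∈ sq2) :
    ‖x‖ * |∫ y in sq2, (Kbar2 (rep2 (x - y)) + h (rep2 (x - y)))
              * (ε⁻¹ ^ 2 * p (ε⁻¹ • y))| ≤ 2 + |M| + B * ∫ z, phi2 z := by
  have hB0 : 0 ≤ B := (hp0 0).trans (hB 0)
  let G : EuclideanSpace ℝ (Fin 2) → ℝ := fun w => (2 + |M|) * p w + B * phi2 (ε⁻¹ • x - w)
  have hG0 : ∀ w, 0 ≤ G w := fun w => by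
    have := hp0 w
    have := phi2_nonneg (ε⁻¹ • x - w)
    positivity
  have hφi : Integrable (fun w => phi2 (ε⁻¹ • x - w)) := phi2_integrable.comp_sub_left _
  have hGi : Integrable G := (hpint.const_mul _).add (hφi.const_mul _)
  have hGv : ∫ w, G w = 2 + |M| + B * ∫ z, phi2 z := by
    simp only [G]
    rw [integral_add (hpint.const_mul _) (hφi.const_mul _), integral_const_mul,
      integral_const_mul, hpi, integral_sub_left_eq_self phi2]
    ring
  have hGs : Integrable (fun y => ε⁻¹ ^ 2 * G (ε⁻¹ • y)) :=
    ((integrable_comp_smul_iff volume G (inv_ne_zero h0.ne')).2 hGi).const_mul _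
  have hGsv : ∫ y, ε⁻¹ ^ 2 * G (ε⁻¹ • y) = ∫ w, G w := by
    rw [integral_const_mul, Measure.integral_comp_smul]
    simp only [finrank_euclideanSpace, Fintype.card_fin, smul_eq_mul]
    rw [abs_of_pos (by positivity)]
    field_simp
  rw [← hGv, ← hGsv]
  have e : ‖x‖ * |∫ y in sq2, (Kbar2 (rep2 (x - y)) + h (rep2 (x - y)))
              * (ε⁻¹ ^ 2 * p (ε⁻¹ • y))| =
      ‖∫ y in sq2, ‖x‖ * ((Kbar2 (rep2 (x - y)) + h (rep2 (x - y)))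
              * (ε⁻¹ ^ 2 * p (ε⁻¹ • y)))‖ := by
    rw [integral_const_mul, norm_mul, norm_norm, Real.norm_eq_abs]
  rw [e]
  refine (norm_integral_le_of_norm_le hGs.integrableOn (Filter.Eventually.of_forall ?_)).trans
    (setIntegral_le_integral hGs (Filter.Eventually.of_forall ?_))
  · intro y
    have := pointwise_bound p hp0 hps B hB M h hM ε h0 he x y hx
    have hpn := hp0 (ε⁻¹ • y)
    rw [norm_mul, norm_mul, norm_norm, Real.norm_eq_abs,
      Real.norm_of_nonneg (by positivity : 0 ≤ ε⁻¹ ^ 2 * p (ε⁻¹ • y))]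
    calc _ = ε⁻¹ ^ 2 * (‖x‖ * (|Kbar2 (rep2 (x - y)) + h (rep2 (x - y))| * p (ε⁻¹ • y))) := by
          ring
      _ ≤ _ := by gcongr
  · intro y
    have := hG0 (ε⁻¹ • y)
    simp only [Pi.zero_apply]
    positivity

lemma sq2_meas : MeasurableSet sq2 := by
  have : sq2 = ⋂ i, {x : EuclideanSpace ℝ (Fin 2) | x i ∈ Set.Icc (-(1/2) : ℝ) (1/2)} := by
    ext x; simp [sq2]
  rw [this]
  refine MeasurableSet.iInter fun i => ?_
  exact (by fun_prop : Measurable fun x : EuclideanSpace ℝ (Fin 2) => x i) measurableSet_Icc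

/-- With the torus kernel `K₂ = K̄₂ + h` (`|h| ≤ M`), there is a constant `C = C(p,M)`
such that for all `ε ∈ (0,1/4]`, `∫_{[−1/2,1/2]²} (K₂ ∗ p^ε(x))² |x| dx ≤ C`. -/
theorem torus_kernel_convolution_weighted_bound
    (p : EuclideanSpace ℝ (Fin 2) → ℝ) (hp : ContDiff ℝ (⊤ : ℕ∞) p)
    (hp0 : ∀ x, 0 ≤ p x) (hps : ∀ x, p x ≠ 0 → ‖x‖ < 1/2)
    (hpi : (∫ x : EuclideanSpace ℝ (Fin 2), p x) = 1) (M : ℝ) :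
    ∃ C : ℝ, 0 < C ∧
      ∀ h : EuclideanSpace ℝ (Fin 2) → ℝ, Measurable h → (∀ x, |h x| ≤ M) →
      ∀ ε : ℝ, ε ∈ Set.Ioc (0 : ℝ) (1/4) →
        (∫ x in sq2,
            (∫ y in sq2, (Kbar2 (rep2 (x - y)) + h (rep2 (x - y)))
              * (ε⁻¹ ^ 2 * p (ε⁻¹ • y))) ^ 2 * ‖x‖) ≤ C := by
  have hcs : HasCompactSupport p := by
    refine HasCompactSupport.of_support_subset_isCompact
      (isCompact_closedBall (0 : EuclideanSpace ℝ (Fin 2)) (1/2)) ?_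
    intro x hx
    simpa using (hps x hx).le
  have hpint : Integrable p := hp.continuous.integrable_of_hasCompactSupport hcs
  obtain ⟨B, hB⟩ := hcs.exists_bound_of_continuous hp.continuous
  have hB' : ∀ x, p x ≤ B := fun x => (le_abs_self _).trans (hB x)
  set A : ℝ := 2 + |M| + B * ∫ z, phi2 z with hA
  have hI : 0 ≤ ∫ z, phi2 z := integral_nonneg phi2_nonneg
  refine ⟨A ^ 2 * (∫ z, phi2 z) + 1, by positivity, ?_⟩
  intro h _ hM ε hε
  have key : ∀ x ∈ sq2, (∫ y in sq2, (Kbar2 (rep2 (x - y)) + h (rep2 (x - y)))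
              * (ε⁻¹ ^ 2 * p (ε⁻¹ • y))) ^ 2 * ‖x‖ ≤ A ^ 2 * phi2 x := by
    intro x hx
    have hc := conv_bound p hp0 hps hpint hpi B hB' M h hM ε hε.1 hε.2 x hx
    rw [← hA] at hc
    have hphi : phi2 x = ‖x‖⁻¹ := by
      unfold phi2
      rw [Set.indicator_of_mem (by exact sq2_norm_lt x hx)]
    rw [hphi]
    by_cases hx0 : x = 0
    · simp [hx0]
    have hx0 : 0 < ‖x‖ := norm_pos_iff.2 hx0
    rw [← div_eq_mul_inv, le_div_iff₀ hx0]
    set F := ∫ y in sq2, (Kbar2 (rep2 (x - y)) + h (rep2 (x - y)))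
              * (ε⁻¹ ^ 2 * p (ε⁻¹ • y))
    calc F ^ 2 * ‖x‖ * ‖x‖ = (‖x‖ * |F|) ^ 2 := by rw [mul_pow, sq_abs]; ring
      _ ≤ A ^ 2 := by gcongr
  have hφA : Integrable (fun x => A ^ 2 * phi2 x) := phi2_integrable.const_mul _
  have step : (∫ x in sq2,
            (∫ y in sq2, (Kbar2 (rep2 (x - y)) + h (rep2 (x - y)))
              * (ε⁻¹ ^ 2 * p (ε⁻¹ • y))) ^ 2 * ‖x‖) ≤ ∫ x in sq2, A ^ 2 * phi2 x := by
    refine integral_mono_of_nonneg (Filter.Eventually.of_forall fun x => ?_)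
      hφA.integrableOn ?_
    · simp only [Pi.zero_apply]
      positivity
    · exact (ae_restrict_iff' sq2_meas).2 (Filter.Eventually.of_forall key)
  have step2 : ∫ x in sq2, A ^ 2 * phi2 x ≤ ∫ x, A ^ 2 * phi2 x :=
    setIntegral_le_integral hφA (Filter.Eventually.of_forall fun x => by
      have := phi2_nonneg x
      simp only [Pi.zero_apply]
      positivity)
  have e := integral_const_mul (μ := (volume : Measure (EuclideanSpace ℝ (Fin 2)))) (A ^ 2) phi2
  linarith
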